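/- Let 𝓢 ⊆ 2^[n] be a nonempty Sperner family of size at most four and h : 𝓢 → 2^[n] a function such that h(S) ⊆ S for every S ∈ 𝓢, and suppose that 𝓕(𝓢,h) is s-extremal. Then there exists a set F ∉ 𝓕(𝓢,h) such that 𝓕(𝓢,h) ∪ {F} is again s-extremal. -/

import Mathlib

open Finset

/-- `𝓕` shatters `S` if every subset of `S` arises as `F ∩ S` for some `F ∈ 𝓕`. -/
def Shatters {n : ℕ} (𝓕 : Finset (Finset (Fin n))) (S : Finset (Fin n)) : Prop :=
  𝓕.image (· ∩ S) = S.powerset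

/-- The family of all subsets of `[n]` shattered by `𝓕`. -/
def ShFam {n : ℕ} (𝓕 : Finset (Finset (Fin n))) : Finset (Finset (Fin n)) :=
  Finset.univ.filter fun S => 𝓕.image (· ∩ S) = S.powerset

/-- A set system is shattering-extremal if it shatters exactly `|𝓕|` sets. -/
def SExtremal {n : ℕ} (𝓕 : Finset (Finset (Fin n))) : Prop :=
  (ShFam 𝓕).card = 𝓕.card

/-- A Sperner family: no member contains another member. -/
def IsSperner {n : ℕ} (𝓢 : Finset (Finset (Fin n))) : Prop :=
  ∀ S ∈ 𝓢, ∀ S' ∈ 𝓢, S ⊆ S' → S = S'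

/-- `Q S H = {T ⊆ [n] : T ∩ S = H}`. -/
def Q {n : ℕ} (S H : Finset (Fin n)) : Finset (Finset (Fin n)) :=
  Finset.univ.filter fun T => T ∩ S = H

/-- `𝓗(𝓢) = {T ⊆ [n] : no S ∈ 𝓢 satisfies S ⊆ T}`. -/
def HFam {n : ℕ} (𝓢 : Finset (Finset (Fin n))) : Finset (Finset (Fin n)) :=
  Finset.univ.filter fun T => ∀ S ∈ 𝓢, ¬ S ⊆ T

/-- `𝓕(𝓢,h) = 2^[n] \ ⋃_{S ∈ 𝓢} Q_{S,h(S)}`. -/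
def FFam {n : ℕ} (𝓢 : Finset (Finset (Fin n))) (h : Finset (Fin n) → Finset (Fin n)) :
    Finset (Finset (Fin n)) :=
  Finset.univ \ 𝓢.biUnion fun S => Q S (h S)



namespace Elim

variable {α : Type*} [DecidableEq α]

/-- `X` lies in the cube `c`. -/
def Mt (X : Finset α) (c : Finset α × Finset α) : Prop := ∀ e ∈ c.1, (e ∈ X ↔ e ∈ c.2)

/-- `c` and `d` disagree at `e`. -/
def Clash (c d : Finset α × Finset α) (e : α) : Prop :=
  e ∈ c.1 ∧ e ∈ d.1 ∧ ¬ (e ∈ c.2 ↔ e ∈ d.2)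

/-- At most one clash. -/
def Rel (c d : Finset α × Finset α) : Prop := ∀ e f, Clash c d e → Clash c d f → e = f

lemma Clash.symm {c d : Finset α × Finset α} {e : α} (h : Clash c d e) : Clash d c e :=
  ⟨h.2.1, h.1, fun h' => h.2.2 h'.symm⟩

lemma Rel.symm {c d : Finset α × Finset α} (h : Rel c d) : Rel d c :=
  fun e f h1 h2 => h e f h1.symm h2.symm

/-! ### Satisfiability of few clauses -/

lemma sat2 {ι : Type*} [DecidableEq ι] (R : Finset ι) (D H : ι → Finset α) (hR : R.card ≤ 2)
    (hD : ∀ c ∈ R, (D c).Nonempty)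
    (hu : ∀ X : Finset α, ∃ c ∈ R, ∀ e ∈ D c, (e ∈ X ↔ e ∈ H c)) :
    ∃ j ∈ R, ∃ k ∈ R, ∃ x, D j = {x} ∧ D k = {x} ∧ ¬ (x ∈ H j ↔ x ∈ H k) := by
  -- find p q with R = {p, q}
  have hne : R.Nonempty := by
    obtain ⟨c, hc, _⟩ := hu ∅
    exact ⟨c, hc⟩
  obtain ⟨p, q, hp, hq, hpq⟩ : ∃ p q, p ∈ R ∧ q ∈ R ∧ ∀ c ∈ R, c = p ∨ c = q := by
    have h1 : 0 < R.card := hne.card_pos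
    have h2 : R.card = 1 ∨ R.card = 2 := by omega
    rcases h2 with h2 | h2
    · obtain ⟨p, rfl⟩ := card_eq_one.1 h2
      exact ⟨p, p, by simp, by simp, by simp⟩
    · obtain ⟨p, q, _, rfl⟩ := card_eq_two.1 h2
      exact ⟨p, q, by simp, by simp, by simp⟩
  have key : ∀ x ∈ D p, ∀ y ∈ D q, x = y ∧ ¬ (x ∈ H p ↔ x ∈ H q) := by
    intro x hx y hy
    by_contra hcon
    obtain ⟨c, hc, hm⟩ := hu (({x} \ H p) ∪ ({y} \ H q))
    rcases hpq c hc with rfl | rfl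
    · have := hm x hx
      simp only [mem_union, mem_sdiff, mem_singleton] at this
      by_cases x = y <;> grind
    · have := hm y hy
      simp only [mem_union, mem_sdiff, mem_singleton] at this
      by_cases x = y <;> grind
  obtain ⟨x, hx⟩ := hD p hp
  obtain ⟨y, hy⟩ := hD q hq
  obtain ⟨rfl, h1⟩ := key x hx y hy
  refine ⟨p, hp, q, hq, x, ?_, ?_, h1⟩
  · ext z
    simp only [mem_singleton]
    exact ⟨fun hz => (key z hz x hy).1, fun hz => hz ▸ hx⟩
  · ext z
    simp only [mem_singleton]
    exact ⟨fun hz => (key x hx z hz).1.symm, fun hz => hz ▸ hy⟩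

/-- Falsify clause `p` at `x` first. -/
lemma satStep {ι : Type*} [DecidableEq ι] (R : Finset ι) (D H : ι → Finset α) (hR : R.card ≤ 3)
    (hu : ∀ X : Finset α, ∃ c ∈ R, ∀ e ∈ D c, (e ∈ X ↔ e ∈ H c))
    (p : ι) (hp : p ∈ R) (x : α) (hx : x ∈ D p)
    (hne : ∀ c ∈ R, D c = {x} → ¬ ¬ (x ∈ H p ↔ x ∈ H c))
    (hD : ∀ c ∈ R, (D c).Nonempty) :
    ∃ j ∈ R, ∃ k ∈ R, ∃ y, j ≠ p ∧ k ≠ p ∧ ¬ (y ∈ H j ↔ y ∈ H k) ∧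
      (D j = {y} ∨ (x ≠ y ∧ D j = {x, y} ∧ ¬ (x ∈ H p ↔ x ∈ H j))) ∧
      (D k = {y} ∨ (x ≠ y ∧ D k = {x, y} ∧ ¬ (x ∈ H p ↔ x ∈ H k))) := by
  classical
  set D' : ι → Finset α := fun c => if (x ∈ H p ↔ x ∈ H c) then D c else (D c).erase x with hD'
  have h1 := sat2 (R.erase p) D' H (by rw [card_erase_of_mem hp]; omega) ?_ ?_
  · obtain ⟨j, hj, k, hk, y, h2, h3, h4⟩ := h1
    have aux : ∀ j, D' j = {y} → j ∈ R → 
        (D j = {y} ∨ (x ≠ y ∧ D j = {x, y} ∧ ¬ (x ∈ H p ↔ x ∈ H j))) := by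
      intro j h2 hj
      simp only [hD'] at h2
      split_ifs at h2 with h5
      · exact Or.inl h2
      · by_cases hxj : x ∈ D j
        · right
          have : y ∈ (D j).erase x := by rw [h2]; simp
          refine ⟨(ne_of_mem_erase this).symm, ?_, h5⟩
          rw [← insert_erase hxj, h2]
        · left
          rwa [erase_eq_of_notMem hxj] at h2
    exact ⟨j, mem_of_mem_erase hj, k, mem_of_mem_erase hk, y, ne_of_mem_erase hj,
      ne_of_mem_erase hk, h4, aux j h2 (mem_of_mem_erase hj), aux k h3 (mem_of_mem_erase hk)⟩
  · intro c hc
    have hc' := mem_of_mem_erase hc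
    simp only [hD']
    split_ifs with h5
    · exact hD c hc'
    · by_contra h6
      rw [not_nonempty_iff_eq_empty, erase_eq_empty_iff] at h6
      rcases h6 with h6 | h6
      · exact (hD c hc').ne_empty h6
      · exact hne c hc' h6 h5
  · intro X
    obtain ⟨c, hc, hm⟩ := hu (if x ∈ H p then X.erase x else insert x X)
    have hcp : c ≠ p := by
      rintro rfl
      have := hm x hx
      split_ifs at this <;> simp_all
    refine ⟨c, mem_erase.2 ⟨hcp, hc⟩, ?_⟩
    intro e he
    have heD : e ∈ D c := by
      simp only [hD'] at he
      split_ifs at he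
      · exact he
      · exact mem_of_mem_erase he
    have h7 := hm e heD
    have hex : e ≠ x := by
      rintro rfl
      simp only [hD'] at he
      split_ifs at he h7 <;> simp_all
    split_ifs at h7 <;> simp_all

lemma sat3 {ι : Type*} [DecidableEq ι] (R : Finset ι) (D H : ι → Finset α) (hR : R.card ≤ 3)
    (hD : ∀ c ∈ R, (D c).Nonempty)
    (hu : ∀ X : Finset α, ∃ c ∈ R, ∀ e ∈ D c, (e ∈ X ↔ e ∈ H c)) :
    (∃ j ∈ R, ∃ k ∈ R, ∃ x, D j = {x} ∧ D k = {x} ∧ ¬ (x ∈ H j ↔ x ∈ H k)) ∨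
    (∃ p ∈ R, ∃ q ∈ R, ∃ r ∈ R, ∃ x y, x ≠ y ∧ D p = {x} ∧ D q = {x, y} ∧
      ¬ (x ∈ H p ↔ x ∈ H q) ∧ ¬ (y ∈ H q ↔ y ∈ H r) ∧
      (D r = {y} ∨ (D r = {x, y} ∧ ¬ (x ∈ H p ↔ x ∈ H r)))) := by
  by_cases hs : ∃ p ∈ R, ∃ x, D p = {x}
  · obtain ⟨p, hp, x, hpx⟩ := hs
    by_cases hA : ∀ c ∈ R, D c = {x} → ¬ ¬ (x ∈ H p ↔ x ∈ H c)
    · obtain ⟨j, hj, k, hk, y, hjp, hkp, hcl, h1, h2⟩ :=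
        satStep R D H hR hu p hp x (by simp [hpx]) hA hD
      rcases h1 with h1 | ⟨hxy, h1, h1'⟩
      · rcases h2 with h2 | ⟨hxy, h2, h2'⟩
        · exact Or.inl ⟨j, hj, k, hk, y, h1, h2, hcl⟩
        · exact Or.inr ⟨p, hp, k, hk, j, hj, x, y, hxy, hpx, h2, h2', fun h => hcl h.symm,
            Or.inl h1⟩
      · refine Or.inr ⟨p, hp, j, hj, k, hk, x, y, hxy, hpx, h1, h1', hcl, ?_⟩
        rcases h2 with h2 | ⟨_, h2, h2'⟩
        · exact Or.inl h2
        · exact Or.inr ⟨h2, h2'⟩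
    · push Not at hA
      obtain ⟨c, hc, h1, h2⟩ := hA
      exact Or.inl ⟨p, hp, c, hc, x, hpx, h1, by grind⟩
  · exfalso
    push Not at hs
    have step : ∀ p ∈ R, ∀ x ∈ D p, ∃ j ∈ R, ∃ k ∈ R, ∃ y, j ≠ p ∧ k ≠ p ∧
        ¬ (y ∈ H j ↔ y ∈ H k) ∧ x ≠ y ∧ D j = {x, y} ∧ ¬ (x ∈ H p ↔ x ∈ H j) ∧
        D k = {x, y} ∧ ¬ (x ∈ H p ↔ x ∈ H k) := by
      intro p hp x hx
      obtain ⟨j, hj, k, hk, y, hjp, hkp, hcl, h1, h2⟩ :=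
        satStep R D H hR hu p hp x hx (fun c hc h => absurd h (hs c hc x)) hD
      have h1 := h1.resolve_left (hs j hj y)
      have h2 := h2.resolve_left (hs k hk y)
      exact ⟨j, hj, k, hk, y, hjp, hkp, hcl, h1.1, h1.2.1, h1.2.2, h2.2.1, h2.2.2⟩
    obtain ⟨p, hp, _⟩ := hu ∅
    obtain ⟨x, hx⟩ := hD p hp
    obtain ⟨q, hq, r, hr, y, hqp, hrp, hqr, hxy, hDq, hpq, hDr, hpr⟩ := step p hp x hx
    have hqr' : q ≠ r := by rintro rfl; exact hqr Iff.rfl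
    have hRe : R = {p, q, r} := by
      symm
      apply eq_of_subset_of_card_le
      · intro c; simp; rintro (rfl | rfl | rfl) <;> assumption
      · rw [card_eq_three.2 ⟨p, q, r, hqp.symm, hrp.symm, hqr', rfl⟩]; exact hR
    -- clear at q with x: then r must disagree with q at x
    obtain ⟨j, hj, k, hk, z, hjq, hkq, hjk, hxz, hDj, hqj, hDk, hqk⟩ :=
      step q hq x (by simp [hDq])
    rw [hRe] at hj hk
    simp only [mem_insert, mem_singleton] at hj hk
    grind

/-! ### The combinatorial core -/

/-- Type A obstruction at `i`. -/
def TA (i j k : Finset α × Finset α) (x : α) : Prop :=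
  Rel i j ∧ Rel i k ∧ j.1 \ i.1 = {x} ∧ k.1 \ i.1 = {x} ∧ ¬ (x ∈ j.2 ↔ x ∈ k.2)

/-- Type B obstruction at `i`. -/
def TB (i p q r : Finset α × Finset α) (x y : α) : Prop :=
  Rel i p ∧ Rel i q ∧ Rel i r ∧ x ≠ y ∧ p.1 \ i.1 = {x} ∧ q.1 \ i.1 = {x, y} ∧
      ¬ (x ∈ p.2 ↔ x ∈ q.2) ∧ ¬ (y ∈ q.2 ↔ y ∈ r.2) ∧
      (r.1 \ i.1 = {y} ∨ (r.1 \ i.1 = {x, y} ∧ ¬ (x ∈ p.2 ↔ x ∈ r.2)))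

lemma TA.symm {i j k : Finset α × Finset α} {x : α} (h : TA i j k x) : TA i k j x :=
  ⟨h.2.1, h.1, h.2.2.2.1, h.2.2.1, fun h' => h.2.2.2.2 h'.symm⟩

lemma xor_trans {a b c : Prop} (h1 : ¬ (a ↔ b)) (h2 : ¬ (b ↔ c)) : (a ↔ c) := by
  by_cases a <;> by_cases b <;> by_cases c <;> simp_all

lemma not_symm {a b : Prop} (h1 : ¬ (a ↔ b)) : ¬ (b ↔ a) := fun h => h1 h.symm

lemma not_of_iff {a b c : Prop} (h1 : a ↔ b) (h2 : ¬ (b ↔ c)) : ¬ (a ↔ c) :=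
  fun h => h2 (h1.symm.trans h)

set_option maxHeartbeats 4000000 in
lemma comb (C : Finset (Finset α × Finset α)) (hcard : C.card ≤ 4) (hne : C.Nonempty)
    (hS : ∀ c ∈ C, ∀ d ∈ C, c ≠ d → (c.1 \ d.1).Nonempty)
    (hG : ∀ i ∈ C, ∀ R : Finset (Finset α × Finset α), (∀ c ∈ R, c ∈ C ∧ c ≠ i) →
      (∀ c ∈ R, ∀ d ∈ R, ∀ e, e ∈ i.1 → ¬ Clash c d e) →
      (∀ X : Finset α, ∃ c ∈ R, ∀ e ∈ c.1 \ i.1, (e ∈ X ↔ e ∈ c.2)) → False)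
    (hU : ∀ i ∈ C, ∀ X : Finset α, ∃ c ∈ C, c ≠ i ∧ Rel i c ∧
      ∀ e ∈ c.1 \ i.1, (e ∈ X ↔ e ∈ c.2)) : False := by
  classical
  have five : ∀ i ∈ C, ∀ j ∈ C, ∀ k ∈ C, ∀ l ∈ C, ∀ m ∈ C, i ≠ j → i ≠ k → i ≠ l → j ≠ k →
      j ≠ l → k ≠ l → m = i ∨ m = j ∨ m = k ∨ m = l := by
    intro i hi j hj k hk l hl m hm h1 h2 h3 h4 h5 h6
    have hRe : ({i, j, k, l} : Finset _) = C := by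
      apply eq_of_subset_of_card_le
      · intro c; simp; rintro (rfl | rfl | rfl | rfl) <;> assumption
      · rw [card_insert_of_notMem (by simp [h1, h2, h3]), card_insert_of_notMem (by simp [h4, h5]),
          card_insert_of_notMem (by simp [h6]), card_singleton]; exact hcard
    rw [← hRe] at hm
    simpa using hm
  -- hG for a pair
  have hG2 : ∀ i ∈ C, ∀ j ∈ C, ∀ k ∈ C, j ≠ i → k ≠ i → ∀ x, Rel j k → j.1 \ i.1 = {x} →
      k.1 \ i.1 = {x} → ¬ (x ∈ j.2 ↔ x ∈ k.2) → False := by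
    intro i hi j hj k hk hji hki x hrel h1 h2 h3
    have hxj : x ∈ j.1 \ i.1 := by rw [h1]; simp
    have hxk : x ∈ k.1 \ i.1 := by rw [h2]; simp
    rw [mem_sdiff] at hxj hxk
    have hcl : Clash j k x := ⟨hxj.1, hxk.1, h3⟩
    refine hG i hi {j, k} ?_ ?_ ?_
    · simp [hj, hk, hji, hki]
    · intro c hc d hd e he hcd
      simp only [mem_insert, mem_singleton] at hc hd
      have : Clash j k e := by
        rcases hc with rfl | rfl <;> rcases hd with rfl | rfl
        · exact absurd Iff.rfl hcd.2.2
        · exact hcd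
        · exact hcd.symm
        · exact absurd Iff.rfl hcd.2.2
      have := hrel _ _ this hcl
      subst this
      exact hxj.2 he
    · intro X
      by_cases hx : x ∈ X ↔ x ∈ j.2
      · exact ⟨j, by simp, by simp [h1, hx]⟩
      · refine ⟨k, by simp, ?_⟩
        simp only [h2, mem_singleton, forall_eq]
        exact xor_trans hx h3
  -- Type A propagates
  have A1 : ∀ i ∈ C, ∀ j ∈ C, ∀ k ∈ C, i ≠ j → i ≠ k → ∀ x, TA i j k x →
      ∃ l ∈ C, l ≠ i ∧ l ≠ j ∧ l ≠ k ∧ ∃ a, TA j i l a := by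
    intro i hi j hj k hk hij hik x hTA
    obtain ⟨h1, h2, h3, h4, h5⟩ := hTA
    have hjk : j ≠ k := by rintro rfl; exact h5 Iff.rfl
    have hnr : ¬ Rel j k := fun hr => hG2 i hi j hj k hk hij.symm hik.symm x hr h3 h4 h5
    obtain ⟨j', hj', k', hk', a, g1, g2, g3⟩ :=
      sat2 (C.filter fun c => c ≠ j ∧ Rel j c) (fun c => c.1 \ j.1) (fun c => c.2) (by
        have : (C.filter fun c => c ≠ j ∧ Rel j c) ⊆ (C.erase j).erase k := by
          intro c
          simp only [mem_filter, mem_erase]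
          rintro ⟨a, b, c⟩
          refine ⟨?_, b, a⟩
          rintro rfl
          exact hnr c
        have := card_le_card this
        rw [card_erase_of_mem (mem_erase.2 ⟨hjk.symm, hk⟩), card_erase_of_mem hj] at this
        omega) (by
        intro c hc
        simp only [mem_filter] at hc
        exact hS c hc.1 j hj hc.2.1) (by
        intro X
        obtain ⟨c, hc, h⟩ := hU j hj X
        exact ⟨c, mem_filter.2 ⟨hc, h.1, h.2.1⟩, h.2.2⟩)
    simp only [mem_filter] at hj' hk'
    have e1 : j' ≠ k := by rintro rfl; exact hnr hj'.2.2
    have e2 : k' ≠ k := by rintro rfl; exact hnr hk'.2.2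
    have e3 : j' ≠ k' := by rintro rfl; exact g3 Iff.rfl
    by_cases e4 : j' = i
    · subst e4
      exact ⟨k', hk'.1, e3.symm, hk'.2.1, e2, a, hj'.2.2, hk'.2.2, g1, g2, g3⟩
    · have e5 : k' = i := by
        rcases five i hi j hj k hk j' hj'.1 k' hk'.1 hij hik (Ne.symm e4) hjk (Ne.symm hj'.2.1)
          (Ne.symm e1) with h | h | h | h
        · exact h
        · exact absurd h hk'.2.1
        · exact absurd h e2
        · exact absurd h.symm e3
      subst e5
      exact ⟨j', hj'.1, e3, hj'.2.1, e1, a, hk'.2.2, hj'.2.2, g2, g1, fun h => g3 h.symm⟩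
  have noA : ∀ i ∈ C, ∀ j ∈ C, ∀ k ∈ C, i ≠ j → i ≠ k → ∀ x, TA i j k x → False := by
    intro i hi j hj k hk hij hik x hTA
    have hjk : j ≠ k := by rintro rfl; exact hTA.2.2.2.2 Iff.rfl
    obtain ⟨l, hl, hli, hlj, hlk, a, hA⟩ := A1 i hi j hj k hk hij hik x hTA
    obtain ⟨l', hl', hli', hlk', hlj', b, hB⟩ := A1 i hi k hk j hj hik hij x hTA.symm
    have : l' = l := by
      rcases five i hi j hj k hk l hl l' hl' hij hik hli.symm hjk hlj.symm hlk.symm with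
        h | h | h | h
      · exact absurd h hli'
      · exact absurd h hlj'
      · exact absurd h hlk'
      · exact h
    subst this
    obtain ⟨m, hm, hmj, hml, hmi, y, hY⟩ := A1 j hj l' hl i hi hlj.symm hij.symm a hA.symm
    have : m = k := by
      rcases five i hi j hj k hk l' hl m hm hij hik hli.symm hjk hlj.symm hlk.symm with
        h | h | h | h
      · exact absurd h hmi
      · exact absurd h hmj
      · exact h
      · exact absurd h hml
    subst this
    obtain ⟨a1, a2, a3, a4, a5⟩ := hTA
    obtain ⟨b1, b2, b3, b4, b5⟩ := hA
    obtain ⟨c1, c2, c3, c4, c5⟩ := hB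
    obtain ⟨d1, d2, d3, d4, d5⟩ := hY
    obtain ⟨z, hz⟩ := hS l' hl i hi hli
    simp only [Finset.ext_iff, mem_sdiff, mem_singleton] at a3 a4 b3 b4 c3 c4
    have d3' := d3
    have d4' := d4
    simp only [Finset.ext_iff, mem_sdiff, mem_singleton] at d3' d4'
    rw [mem_sdiff] at hz
    have hy := (d3' y).2 rfl
    have hal := (b4 a).2 rfl
    have hai := (b3 a).2 rfl
    have hyi : y ∈ i.1 := by
      by_contra hyi
      have e1 : y = x := (a3 y).1 ⟨hy.1, hyi⟩
      have e2 : z ∈ j.1 := by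
        by_contra h
        have e3 : z = a := (b4 z).1 ⟨hz.1, h⟩
        exact hz.2 (e3 ▸ hai.1)
      have e4 : z = x := (a3 z).1 ⟨e2, hz.2⟩
      exact hy.2 (by rw [e1, ← e4]; exact hz.1)
    have hiy : i.1 \ l'.1 = {y} := by
      ext w
      simp only [mem_sdiff, mem_singleton]
      constructor
      · rintro ⟨h1, h2⟩
        by_cases h3 : w ∈ j.1
        · exact (d3' w).1 ⟨h3, h2⟩
        · have e3 : w = a := (b3 w).1 ⟨h1, h3⟩
          exact absurd (e3 ▸ hal.1) h2
      · rintro rfl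
        exact ⟨hyi, hy.2⟩
    by_cases hc : y ∈ i.2 ↔ y ∈ j.2
    · exact hG2 l' hl i hi m hk hli.symm hlk.symm y a2 hiy d4 (not_of_iff hc d5)
    · exact hG2 l' hl i hi j hj hli.symm hlj.symm y a1 hiy d3 hc
  -- hence type B everywhere
  have allB : ∀ i ∈ C, ∃ p ∈ C, ∃ q ∈ C, ∃ r ∈ C, p ≠ i ∧ q ≠ i ∧ r ≠ i ∧ 
      ∃ x y, TB i p q r x y := by
    intro i hi
    rcases sat3 (C.filter fun c => c ≠ i ∧ Rel i c) (fun c => c.1 \ i.1) (fun c => c.2) (by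
        have : (C.filter fun c => c ≠ i ∧ Rel i c) ⊆ C.erase i := by
          intro c
          simp only [mem_filter, mem_erase]
          exact fun h => ⟨h.2.1, h.1⟩
        have := card_le_card this
        rw [card_erase_of_mem hi] at this
        omega) (by
        intro c hc
        simp only [mem_filter] at hc
        exact hS c hc.1 i hi hc.2.1) (by
        intro X
        obtain ⟨c, hc, h⟩ := hU i hi X
        exact ⟨c, mem_filter.2 ⟨hc, h.1, h.2.1⟩, h.2.2⟩) with
      ⟨j, hj, k, hk, x, h1, h2, h3⟩ | ⟨p, hp, q, hq, r, hr, x, y, h⟩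
    · exfalso
      simp only [mem_filter] at hj hk
      exact noA i hi j hj.1 k hk.1 hj.2.1.symm hk.2.1.symm x ⟨hj.2.2, hk.2.2, h1, h2, h3⟩
    · simp only [mem_filter] at hp hq hr
      exact ⟨p, hp.1, q, hq.1, r, hr.1, hp.2.1, hq.2.1, hr.2.1, x, y,
        hp.2.2, hq.2.2, hr.2.2, h⟩
  have TBne : ∀ (i p q r : Finset α × Finset α) (x y : α), TB i p q r x y → p ≠ q ∧ p ≠ r ∧ q ≠ r := by
    rintro i p q r x y ⟨h1, h2, h3, hxy, h4, h5, h6, h7, h8⟩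
    refine ⟨?_, ?_, ?_⟩
    · rintro rfl; exact h6 Iff.rfl
    · rintro rfl
      rcases h8 with h8 | h8
      · rw [h4, singleton_inj] at h8; exact hxy h8
      · exact h8.2 Iff.rfl
    · rintro rfl; exact h7 Iff.rfl
  have allRel : ∀ i ∈ C, ∀ j ∈ C, i ≠ j → Rel i j := by
    intro i hi j hj hij
    obtain ⟨p, hp, q, hq, r, hr, hpi, hqi, hri, x, y, hT⟩ := allB i hi
    obtain ⟨n1, n2, n3⟩ := TBne _ _ _ _ _ _ hT
    obtain ⟨h1, h2, h3, _⟩ := hT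
    rcases five i hi p hp q hq r hr j hj hpi.symm hqi.symm hri.symm n1 n2 n3 with
      h | h | h | h
    · exact absurd h.symm hij
    all_goals subst h; assumption
  -- in type B, the shape is the first one and p, r clash inside i
  have B1 : ∀ i ∈ C, ∀ p ∈ C, ∀ q ∈ C, ∀ r ∈ C, p ≠ i → q ≠ i → r ≠ i → ∀ x y,
      TB i p q r x y → r.1 \ i.1 = {y} ∧ ∃ w ∈ i.1, Clash p r w := by
    intro i hi p hp q hq r hr hpi hqi hri x y hT
    obtain ⟨n1, n2, n3⟩ := TBne _ _ _ _ _ _ hT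
    obtain ⟨h1, h2, h3, hxy, h4, h5, h6, h7, h8⟩ := hT
    have k4 := h4
    have k5 := h5
    have k8 := h8
    simp only [Finset.ext_iff, mem_sdiff, mem_singleton, mem_insert] at k4 k5 k8
    have rpq := allRel p hp q hq n1
    have rqr := allRel q hq r hr n3
    have rpr := allRel p hp r hr n2
    have cpq : Clash p q x := ⟨((k4 x).2 rfl).1, ((k5 x).2 (Or.inl rfl)).1, h6⟩
    have hyr : y ∈ r.1 := by
      rcases k8 with k8 | k8
      · exact ((k8 y).2 rfl).1
      · exact ((k8.1 y).2 (Or.inr rfl)).1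
    have cqr : Clash q r y := ⟨((k5 y).2 (Or.inr rfl)).1, hyr, h7⟩
    have hxi : x ∉ i.1 := ((k4 x).2 rfl).2
    have hyi : y ∉ i.1 := ((k5 y).2 (Or.inr rfl)).2
    have npq : ∀ e ∈ i.1, ¬ Clash p q e := fun e he hc => hxi (rpq _ _ hc cpq ▸ he)
    have nqr : ∀ e ∈ i.1, ¬ Clash q r e := fun e he hc => hyi (rqr _ _ hc cqr ▸ he)
    by_cases hw : ∃ w ∈ i.1, Clash p r w
    · refine ⟨?_, hw⟩
      rcases h8 with h8 | ⟨h8, h9⟩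
      · exact h8
      · exfalso
        obtain ⟨w, hw, hc⟩ := hw
        have hxr : x ∈ r.1 \ i.1 := by rw [h8]; simp
        have cpr : Clash p r x := ⟨cpq.1, (mem_sdiff.1 hxr).1, h9⟩
        exact hxi (rpr _ _ hc cpr ▸ hw)
    · exfalso
      push Not at hw
      refine hG i hi {p, q, r} ?_ ?_ ?_
      · simp [hp, hq, hr, hpi, hqi, hri]
      · intro c hc d hd e he hcd
        simp only [mem_insert, mem_singleton] at hc hd
        rcases hc with rfl | rfl | rfl <;> rcases hd with rfl | rfl | rfl
        · exact hcd.2.2 Iff.rfl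
        · exact npq e he hcd
        · exact hw e he hcd
        · exact npq e he hcd.symm
        · exact hcd.2.2 Iff.rfl
        · exact nqr e he hcd
        · exact hw e he hcd.symm
        · exact nqr e he hcd.symm
        · exact hcd.2.2 Iff.rfl
      · intro X
        by_cases hx : x ∈ X ↔ x ∈ p.2
        · exact ⟨p, by simp, by simp [h4, hx]⟩
        · by_cases hy : y ∈ X ↔ y ∈ q.2
          · refine ⟨q, by simp, ?_⟩
            simp only [h5, mem_singleton, mem_insert, forall_eq_or_imp, forall_eq]
            exact ⟨xor_trans hx h6, hy⟩
          · refine ⟨r, by simp, ?_⟩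
            rcases h8 with h8 | ⟨h8, h9⟩
            · simp only [h8, mem_singleton, forall_eq]
              exact xor_trans hy h7
            · simp only [h8, mem_singleton, mem_insert, forall_eq_or_imp, forall_eq]
              exact ⟨xor_trans hx h9, xor_trans hy h7⟩
  have TBfull : ∀ i ∈ C, ∀ j ∈ C, ∀ k ∈ C, i ≠ j → i ≠ k → j ≠ k →
      (∃ e, Clash j k e) ∧ ((∃ x, j.1 \ i.1 = {x}) ∨ (∃ x, k.1 \ i.1 = {x})) := by
    intro i hi j hj k hk hij hik hjk
    obtain ⟨p, hp, q, hq, r, hr, hpi, hqi, hri, x, y, hT⟩ := allB i hi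
    obtain ⟨n1, n2, n3⟩ := TBne _ _ _ _ _ _ hT
    obtain ⟨h9, w, hwi, hw⟩ := B1 i hi p hp q hq r hr hpi hqi hri x y hT
    obtain ⟨h1, h2, h3, hxy, h4, h5, h6, h7, h8⟩ := hT
    have k4 := h4
    have k5 := h5
    have k9 := h9
    simp only [Finset.ext_iff, mem_sdiff, mem_singleton, mem_insert] at k4 k5 k9
    have cpq : Clash p q x := ⟨((k4 x).2 rfl).1, ((k5 x).2 (Or.inl rfl)).1, h6⟩
    have cqr : Clash q r y := ⟨((k5 y).2 (Or.inr rfl)).1, ((k9 y).2 rfl).1, h7⟩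
    have hj' := five i hi p hp q hq r hr j hj hpi.symm hqi.symm hri.symm n1 n2 n3
    have hk' := five i hi p hp q hq r hr k hk hpi.symm hqi.symm hri.symm n1 n2 n3
    rcases hj' with h | h | h | h
    · exact absurd h.symm hij
    all_goals
      subst h
      rcases hk' with h | h | h | h
      · exact absurd h.symm hik
      all_goals
        subst h
        first
        | exact absurd rfl hjk
        | exact ⟨⟨_, cpq⟩, by first | exact Or.inl ⟨_, h4⟩ | exact Or.inr ⟨_, h4⟩⟩
        | exact ⟨⟨_, cpq.symm⟩, by first | exact Or.inl ⟨_, h4⟩ | exact Or.inr ⟨_, h4⟩ | exact Or.inl ⟨_, h9⟩ | exact Or.inr ⟨_, h9⟩⟩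
        | exact ⟨⟨_, cqr⟩, by first | exact Or.inl ⟨_, h4⟩ | exact Or.inr ⟨_, h4⟩ | exact Or.inl ⟨_, h9⟩ | exact Or.inr ⟨_, h9⟩⟩
        | exact ⟨⟨_, cqr.symm⟩, by first | exact Or.inl ⟨_, h4⟩ | exact Or.inr ⟨_, h4⟩ | exact Or.inl ⟨_, h9⟩ | exact Or.inr ⟨_, h9⟩⟩
        | exact ⟨⟨_, hw⟩, by first | exact Or.inl ⟨_, h4⟩ | exact Or.inr ⟨_, h4⟩ | exact Or.inl ⟨_, h9⟩ | exact Or.inr ⟨_, h9⟩⟩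
        | exact ⟨⟨_, hw.symm⟩, by first | exact Or.inl ⟨_, h4⟩ | exact Or.inr ⟨_, h4⟩ | exact Or.inl ⟨_, h9⟩ | exact Or.inr ⟨_, h9⟩⟩
  -- final contradiction
  have fin : ∀ i ∈ C, ∀ p ∈ C, ∀ q ∈ C, ∀ r ∈ C, p ≠ i → q ≠ i → r ≠ i →
      p ≠ q → p ≠ r → q ≠ r → ∀ x y w, x ≠ y → p.1 \ i.1 = {x} → q.1 \ i.1 = {x, y} →
      r.1 \ i.1 = {y} → ¬ (x ∈ p.2 ↔ x ∈ q.2) → ¬ (y ∈ q.2 ↔ y ∈ r.2) → w ∈ i.1 →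
      Clash p r w → Clash i p w → False := by
    intro i hi p hp q hq r hr hpi hqi hri n1 n2 n3 x y w hxy h4 h5 h6 h7 h8 hwi hw hc
    obtain ⟨⟨u, hu⟩, _⟩ := TBfull p hp i hi q hq hpi n1 hqi.symm
    obtain ⟨⟨v, hv⟩, _⟩ := TBfull p hp i hi r hr hpi n2 hri.symm
    obtain ⟨_, hsz⟩ := TBfull p hp q hq r hr n1 n2 n3
    have rpq := allRel p hp q hq n1
    have rpr := allRel p hp r hr n2
    have rip := allRel i hi p hp hpi.symm
    simp only [Finset.ext_iff, mem_sdiff, mem_singleton, mem_insert] at h4 h5 h6 hsz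
    have cpq : Clash p q x := ⟨((h4 x).2 rfl).1, ((h5 x).2 (Or.inl rfl)).1, h7⟩
    have cqr : Clash q r y := ⟨((h5 y).2 (Or.inr rfl)).1, ((h6 y).2 rfl).1, h8⟩
    have hyi : y ∉ i.1 := ((h6 y).2 rfl).2
    have hxi : x ∉ i.1 := ((h4 x).2 rfl).2
    have hyp : y ∉ p.1 := fun h => hxy ((h4 y).1 ⟨h, hyi⟩).symm
    have hup : u ∉ p.1 := by
      intro hup
      have : ¬ Clash p q u := fun h => hxi (rpq _ _ h cpq ▸ hu.1)
      have h1 : Clash i p u := ⟨hu.1, hup, fun h => this ⟨hup, hu.2.1, fun h' => hu.2.2 (h.trans h')⟩⟩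
      have h2 := rip _ _ h1 hc
      subst h2
      have h4 : u ∈ i.2 ↔ u ∈ r.2 := xor_trans hc.2.2 hw.2.2
      have rqr := allRel q hq r hr n3
      have h5 : Clash q r u := ⟨hu.2.1, hw.2.1, fun h => hu.2.2 (h4.trans h.symm)⟩
      exact hyi (rqr _ _ h5 cqr ▸ hu.1)
    have hvp : v ∉ p.1 := by
      intro hvp
      by_cases h : Clash i p v
      · have h2 := rip _ _ h hc
        subst h2
        exact hv.2.2 (xor_trans hc.2.2 hw.2.2)
      · have h1 : Clash p r v := ⟨hvp, hv.2.1, fun h' => h ⟨hv.1, hvp, fun h'' => hv.2.2 (h''.trans h')⟩⟩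
        have h2 := rpr _ _ h1 hw
        subst h2
        exact h hc
    have := hu.1
    have := hu.2.1
    have := hv.1
    have := hv.2.1
    have := cqr.1
    have := cqr.2.1
    rcases hsz with ⟨z, hz⟩ | ⟨z, hz⟩
    · have a1 := (hz y).1 ⟨cqr.1, hyp⟩
      have a2 := (hz u).1 ⟨hu.2.1, hup⟩
      exact hyi (by rw [a1, ← a2]; exact hu.1)
    · have a1 := (hz y).1 ⟨cqr.2.1, hyp⟩
      have a2 := (hz v).1 ⟨hv.2.1, hvp⟩
      exact hyi (by rw [a1, ← a2]; exact hv.1)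
  obtain ⟨i, hi⟩ := hne
  obtain ⟨p, hp, q, hq, r, hr, hpi, hqi, hri, x, y, hT⟩ := allB i hi
  obtain ⟨n1, n2, n3⟩ := TBne _ _ _ _ _ _ hT
  obtain ⟨h9, w, hwi, hw⟩ := B1 i hi p hp q hq r hr hpi hqi hri x y hT
  obtain ⟨h1, h2, h3, hxy, h4, h5, h6, h7, h8⟩ := hT
  by_cases hc : w ∈ i.2 ↔ w ∈ p.2
  · refine fin i hi r hr q hq p hp hri hqi hpi n3.symm n2.symm n1.symm y x w hxy.symm h9
      (by rw [h5, pair_comm]) h4 (not_symm h7) (not_symm h6) hwi hw.symm ⟨hwi, hw.2.1, ?_⟩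
    exact not_of_iff hc hw.2.2
  · exact fin i hi p hp q hq r hr hpi hqi hri n1 n2 n3 x y w hxy h4 h5 h9 h6 h7 hwi hw
      ⟨hwi, hw.1, hc⟩

/-! ### Extremal families -/

lemma extremal_proj (F : Finset (Finset α)) (a : α) (hF : F.shatterer.card = F.card) :
    ((F.image fun T => T.erase a).shatterer).card = (F.image fun T => T.erase a).card := by
  classical
  set G := F.image fun T => T.erase a with hG
  set M := (F.filter fun T => a ∉ T ∧ insert a T ∈ F) with hM
  have hGa : ∀ X ∈ G.shatterer, a ∉ X := by
    intro X hX haX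
    rw [mem_shatterer] at hX
    obtain ⟨T, hT, h⟩ := hX (Subset.refl X)
    rw [hG, mem_image] at hT
    obtain ⟨T', _, rfl⟩ := hT
    have : a ∈ X ∩ T'.erase a := by rw [h]; exact haX
    simp at this
  have hMa : ∀ X ∈ M.shatterer, a ∉ X := by
    intro X hX haX
    rw [mem_shatterer] at hX
    obtain ⟨T, hT, h⟩ := hX (Subset.refl X)
    rw [hM, mem_filter] at hT
    have : a ∈ X ∩ T := by rw [h]; exact haX
    exact hT.2.1 (mem_inter.1 this).2
  have hcard : F.card = G.card + M.card := by
    have hsplit : F = M.image (insert a) ∪ F.filter (fun T => ¬ (a ∈ T ∧ T.erase a ∈ F)) := by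
      ext T
      simp only [mem_union, mem_image, mem_filter, hM]
      constructor
      · intro hT
        by_cases h : a ∈ T ∧ T.erase a ∈ F
        · left
          exact ⟨T.erase a, ⟨h.2, by simp, by rwa [insert_erase h.1]⟩, insert_erase h.1⟩
        · exact Or.inr ⟨hT, h⟩
      · rintro (⟨T', h, rfl⟩ | h)
        · exact h.2.2
        · exact h.1
    have hdisj : Disjoint (M.image (insert a)) (F.filter (fun T => ¬ (a ∈ T ∧ T.erase a ∈ F))) := by
      rw [disjoint_left]
      intro T h1 h2
      simp only [mem_image, mem_filter, hM] at h1 h2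
      obtain ⟨T', h, rfl⟩ := h1
      apply h2.2
      refine ⟨by simp, ?_⟩
      rw [erase_insert h.2.1]
      exact h.1
    have c1 : (M.image (insert a)).card = M.card := by
      apply card_image_of_injOn
      intro T hT T' hT' h
      simp only [hM, coe_filter, Set.mem_setOf_eq] at hT hT'
      have := congrArg (fun Z => Z.erase a) h
      simpa [erase_insert hT.2.1, erase_insert hT'.2.1] using this
    have c2 : G.card = (F.filter (fun T => ¬ (a ∈ T ∧ T.erase a ∈ F))).card := by
      have : G = (F.filter (fun T => ¬ (a ∈ T ∧ T.erase a ∈ F))).image fun T => T.erase a := by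
        ext T
        simp only [hG, mem_image, mem_filter]
        constructor
        · rintro ⟨T', h, rfl⟩
          by_cases h' : a ∈ T' ∧ T'.erase a ∈ F
          · exact ⟨T'.erase a, ⟨h'.2, by simp⟩, by simp⟩
          · exact ⟨T', ⟨h, h'⟩, rfl⟩
        · rintro ⟨T', h, rfl⟩
          exact ⟨T', h.1, rfl⟩
      rw [this]
      apply card_image_of_injOn
      intro T hT T' hT' h
      simp only [coe_filter, Set.mem_setOf_eq] at hT hT'
      simp only at h
      by_cases h1 : a ∈ T <;> by_cases h2 : a ∈ T'
      · rw [← insert_erase h1, h, insert_erase h2]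
      · rw [erase_eq_of_notMem h2] at h
        exact absurd ⟨h1, h ▸ hT'.1⟩ hT.2
      · rw [erase_eq_of_notMem h1] at h
        exact absurd ⟨h2, h ▸ hT.1⟩ hT'.2
      · rwa [erase_eq_of_notMem h1, erase_eq_of_notMem h2] at h
    calc F.card = (M.image (insert a) ∪ F.filter (fun T => ¬ (a ∈ T ∧ T.erase a ∈ F))).card := by
          rw [← hsplit]
      _ = _ := by rw [card_union_of_disjoint hdisj, c1, c2, add_comm]
  have hsub : G.shatterer ∪ M.shatterer.image (insert a) ⊆ F.shatterer := by
    intro X hX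
    rw [mem_union] at hX
    rw [mem_shatterer]
    rcases hX with hX | hX
    · have ha := hGa X hX
      rw [mem_shatterer] at hX
      intro Y hY
      obtain ⟨T, hT, h⟩ := hX hY
      rw [hG, mem_image] at hT
      obtain ⟨T', hT', rfl⟩ := hT
      refine ⟨T', hT', ?_⟩
      rw [← h]
      ext e
      simp only [mem_inter, mem_erase]
      constructor
      · rintro ⟨h1, h2⟩
        exact ⟨h1, fun h3 => ha (h3 ▸ h1), h2⟩
      · tauto
    · rw [mem_image] at hX
      obtain ⟨X', hX', rfl⟩ := hX
      have ha := hMa X' hX'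
      rw [mem_shatterer] at hX'
      intro Y hY
      have hY' : Y.erase a ⊆ X' := by
        intro e he
        have := hY (mem_of_mem_erase he)
        rw [mem_insert] at this
        exact this.resolve_left (ne_of_mem_erase he)
      obtain ⟨T, hT, h⟩ := hX' hY'
      rw [hM, mem_filter] at hT
      by_cases haY : a ∈ Y
      · refine ⟨insert a T, hT.2.2, ?_⟩
        rw [← insert_inter_distrib, h, insert_erase haY]
      · refine ⟨T, hT.1, ?_⟩
        rw [insert_inter_of_notMem hT.2.1, h, erase_eq_of_notMem haY]
  have hdis : Disjoint G.shatterer (M.shatterer.image (insert a)) := by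
    rw [disjoint_left]
    intro X h1 h2
    rw [mem_image] at h2
    obtain ⟨X', _, rfl⟩ := h2
    exact hGa _ h1 (by simp)
  have hle := card_le_card hsub
  rw [card_union_of_disjoint hdis, card_image_of_injOn (by
    intro T hT T' hT' h
    have h1 := hMa T hT
    have h2 := hMa T' hT'
    have := congrArg (fun Z => Z.erase a) h
    simpa [erase_insert h1, erase_insert h2] using this)] at hle
  have h1 := card_le_card_shatterer G
  have h2 := card_le_card_shatterer M
  omega

lemma extremal_trace (F : Finset (Finset α)) (A : Finset α) (hF : F.shatterer.card = F.card) :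
    ((F.image fun T => T \ A).shatterer).card = (F.image fun T => T \ A).card := by
  induction A using Finset.induction_on with
  | empty => simpa using hF
  | insert a A _ ih =>
    have := extremal_proj _ a ih
    rw [image_image] at this
    have e : ((fun T : Finset α => T.erase a) ∘ fun T => T \ A) = fun T => T \ insert a A := by
      funext T
      simp only [Function.comp]
      rw [sdiff_insert]
    rwa [e] at this

/-- Two missing traces on `S`: one can drop a coordinate. -/
lemma keyP [Fintype α] (F : Finset (Finset α)) (hF : F.shatterer.card = F.card)
    (S H K : Finset α) (hH : ∀ X ∈ F, ¬ Mt X (S, H)) (hK : ∀ X ∈ F, ¬ Mt X (S, K))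
    (hHK : ¬ Mt H (S, K)) : ∃ e ∈ S, ∀ X ∈ F, ¬ Mt X (S.erase e, H) := by
  classical
  by_contra hcon
  push Not at hcon
  set G := F.image fun T => T \ Sᶜ with hGdef
  have hG : G.shatterer.card = G.card := extremal_trace F Sᶜ hF
  have hmem : ∀ X, X ∈ G ↔ ∃ T ∈ F, T ∩ S = X := by
    intro X
    simp [hGdef, sdiff_compl]
  have hHG : H ∩ S ∉ G := by
    rw [hmem]
    rintro ⟨T, hT, h⟩
    apply hH T hT
    intro e he
    have := Finset.ext_iff.1 h e
    simp only [mem_inter] at this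
    simp only at he ⊢
    tauto
  have hsub : (insert (H ∩ S) G).shatterer ⊆ G.shatterer := by
    intro X hX
    rw [mem_shatterer] at hX ⊢
    have hXS : X ⊆ S := by
      obtain ⟨T, hT, h⟩ := hX (Subset.refl X)
      rw [← h]
      intro e he
      have he := (mem_inter.1 he).2
      rw [mem_insert, hmem] at hT
      rcases hT with rfl | ⟨T', _, rfl⟩
      · exact (mem_inter.1 he).2
      · exact (mem_inter.1 he).2
    have hXne : X ≠ S := by
      rintro rfl
      obtain ⟨T, hT, h⟩ := hX (inter_subset_right (s₁ := K))
      rw [mem_insert, hmem] at hT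
      rcases hT with rfl | ⟨T', hT', rfl⟩
      · apply hHK
        intro e he
        have := Finset.ext_iff.1 h e
        simp only [mem_inter] at this
        simp only at he ⊢
        tauto
      · apply hK T' hT'
        intro e he
        have := Finset.ext_iff.1 h e
        simp only [mem_inter] at this
        simp only at he ⊢
        tauto
    obtain ⟨e, heS, heX⟩ := exists_of_ssubset (hXS.ssubset_of_ne hXne)
    obtain ⟨Z, hZ, hZm⟩ := hcon e heS
    intro Y hY
    obtain ⟨T, hT, h⟩ := hX hY
    rw [mem_insert] at hT
    rcases hT with rfl | hT
    · refine ⟨Z ∩ S, (hmem _).2 ⟨Z, hZ, rfl⟩, ?_⟩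
      rw [← h]
      ext f
      simp only [mem_inter]
      by_cases hf : f ∈ X
      · have := hZm f (by simp only [mem_erase]; exact ⟨fun h => heX (h ▸ hf), hXS hf⟩)
        simp only at this
        tauto
      · tauto
    · exact ⟨T, hT, h⟩
  have h1 := card_le_card hsub
  have h2 := card_le_card_shatterer (insert (H ∩ S) G)
  rw [card_insert_of_notMem hHG] at h2
  omega

lemma corner (F : Finset (Finset α)) (hF : F.shatterer.card = F.card)
    (c : Finset α × Finset α) (hc : ∀ X ∈ F, ¬ Mt X c) (v : Finset α) (hv : Mt v c)
    (hn : ∀ e ∈ c.1, ∃ X ∈ F, ∀ f, f ≠ e → (f ∈ X ↔ f ∈ v)) :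
    (insert v F).shatterer.card = (insert v F).card := by
  have hvF : v ∉ F := fun h => hc v h hv
  have hsub : (insert v F).shatterer ⊆ insert c.1 F.shatterer := by
    intro X hX
    rw [mem_insert]
    by_contra hcon
    push Not at hcon
    obtain ⟨h1, h2⟩ := hcon
    rw [mem_shatterer] at h2 hX
    have hsubX : c.1 ⊆ X := by
      intro e he
      by_contra heX
      apply h2
      intro Y hY
      obtain ⟨T, hT, h⟩ := hX hY
      rw [mem_insert] at hT
      rcases hT with rfl | hT
      · obtain ⟨Z, hZ, hm⟩ := hn e he
        refine ⟨Z, hZ, ?_⟩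
        rw [← h]
        ext f
        simp only [mem_inter]
        by_cases hf : f ∈ X
        · have := hm f (fun h => heX (h ▸ hf))
          tauto
        · tauto
      · exact ⟨T, hT, h⟩
    obtain ⟨f, hfX, hfc⟩ := exists_of_ssubset (hsubX.ssubset_of_ne (Ne.symm h1))
    obtain ⟨T, hT, h⟩ := hX (t := X.filter fun g => ¬ (g = f ↔ g ∈ v)) (filter_subset _ _)
    have hh : ∀ g ∈ X, (g ∈ T ↔ ¬ (g = f ↔ g ∈ v)) := by
      intro g hg
      have := Finset.ext_iff.1 h g
      simp only [mem_inter, mem_filter] at this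
      tauto
    rw [mem_insert] at hT
    rcases hT with rfl | hT
    · have := hh f hfX
      tauto
    · apply hc T hT
      intro g hg
      have h3 := hh g (hsubX hg)
      have h4 : g ≠ f := fun h => hfc (h ▸ hg)
      have h5 := hv g hg
      tauto
  have h1 := card_le_card hsub
  have h2 := card_insert_le c.1 F.shatterer
  have h3 := card_le_card_shatterer (insert v F)
  rw [card_insert_of_notMem hvF] at h3 ⊢
  omega

lemma main [Fintype α] (F : Finset (Finset α)) (hF : F.shatterer.card = F.card)
    (hFne : ∃ X, X ∉ F)
    (hex : ∃ C : Finset (Finset α × Finset α), C.card ≤ 4 ∧ ∀ X, X ∉ F ↔ ∃ c ∈ C, Mt X c) :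
    ∃ v, v ∉ F ∧ (insert v F).shatterer.card = (insert v F).card := by
  classical
  by_contra hcon
  push Not at hcon
  -- minimal family
  obtain ⟨C, ⟨hcard, hC⟩, hmin⟩ : ∃ C : Finset (Finset α × Finset α),
      (C.card ≤ 4 ∧ ∀ X, X ∉ F ↔ ∃ c ∈ C, Mt X c) ∧
      ∀ C' : Finset (Finset α × Finset α),
        (C'.card ≤ 4 ∧ ∀ X, X ∉ F ↔ ∃ c ∈ C', Mt X c) →
        ∑ c ∈ C, (c.1.card + 1) ≤ ∑ c ∈ C', (c.1.card + 1) := by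
    let P : Finset (Finset α × Finset α) → Prop := fun C =>
      C.card ≤ 4 ∧ ∀ X, X ∉ F ↔ ∃ c ∈ C, Mt X c
    obtain ⟨C0, hC0⟩ := hex
    obtain ⟨C, hC, hm⟩ := exists_min_image (univ.filter P)
      (fun C => ∑ c ∈ C, (c.1.card + 1)) ⟨C0, by simpa [P] using hC0⟩
    refine ⟨C, by simpa [P] using hC, ?_⟩
    intro C' hC'
    exact hm C' (by simpa [P] using hC')
  have hCF : ∀ c ∈ C, ∀ X ∈ F, ¬ Mt X c := fun c hc X hX h => (hC X).2 ⟨c, hc, h⟩ hX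
  -- irredundancy
  have irr : ∀ c ∈ C, ¬ ∀ X, Mt X c → ∃ d ∈ C, d ≠ c ∧ Mt X d := by
    intro c hc hall
    have := hmin (C.erase c) ⟨(card_erase_le).trans hcard, by
      intro X
      rw [hC X]
      constructor
      · rintro ⟨d, hd, hX⟩
        by_cases h : d = c
        · subst h
          obtain ⟨d', h1, h2, h3⟩ := hall X hX
          exact ⟨d', mem_erase.2 ⟨h2, h1⟩, h3⟩
        · exact ⟨d, mem_erase.2 ⟨h, hd⟩, hX⟩
      · rintro ⟨d, hd, hX⟩
        exact ⟨d, mem_of_mem_erase hd, hX⟩⟩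
    rw [← add_sum_erase C _ hc] at this
    omega
  have maxi : ∀ c ∈ C, ∀ T, T ⊆ c.1 → (∀ X ∈ F, ¬ Mt X (T, c.2)) → T = c.1 := by
    intro c hc T hT hX
    by_contra hne
    have hlt := card_lt_card (hT.ssubset_of_ne hne)
    have := hmin (insert (T, c.2) (C.erase c)) ⟨by
      have := card_insert_le (T, c.2) (C.erase c)
      rw [card_erase_of_mem hc] at this
      have := card_pos.2 ⟨c, hc⟩
      omega, by
      intro X
      constructor
      · intro hXF
        obtain ⟨d, hd, h⟩ := (hC X).1 hXF
        by_cases hdc : d = c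
        · subst hdc
          exact ⟨(T, d.2), by simp, fun e he => h e (hT he)⟩
        · exact ⟨d, by simp [hdc, hd], h⟩
      · rintro ⟨d, hd, h⟩ hXF
        rw [mem_insert] at hd
        rcases hd with rfl | hd
        · exact hX X hXF h
        · exact hCF d (mem_of_mem_erase hd) X hXF h⟩
    have h2 : ∑ d ∈ insert (T, c.2) (C.erase c), (d.1.card + 1) ≤
        (T.card + 1) + ∑ d ∈ C.erase c, (d.1.card + 1) := by
      by_cases h : (T, c.2) ∈ C.erase c
      · rw [insert_eq_of_mem h]; omega
      · rw [sum_insert h]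
    rw [← add_sum_erase C _ hc] at this
    omega
  have C2 : ∀ c ∈ C, ∀ T K, T ⊆ c.1 → (∀ X, Mt X (T, K) → ∃ d ∈ C, d ≠ c ∧ Mt X d) → False := by
    intro c hc T K hT hall
    have hTF : ∀ X ∈ F, ¬ Mt X (T, K) := by
      intro X hX h
      obtain ⟨d, hd, _, h'⟩ := hall X h
      exact hCF d hd X hX h'
    have hagree : Mt c.2 (c.1, K) := by
      by_contra hne
      obtain ⟨e, he, h⟩ := keyP F hF c.1 c.2 K (hCF c hc)
        (fun X hX h => hTF X hX fun e he => h e (hT he)) hne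
      have := maxi c hc _ (erase_subset e c.1) h
      rw [← this] at he
      simp at he
    apply irr c hc
    intro X hX
    exact hall X fun e he => (hX e (hT he)).trans (hagree e (hT he))
  refine comb C hcard ?_ ?_ ?_ ?_
  · obtain ⟨X, hX⟩ := hFne
    obtain ⟨c, hc, _⟩ := (hC X).1 hX
    exact ⟨c, hc⟩
  · intro c hc d hd hcd
    by_contra h
    rw [not_nonempty_iff_eq_empty, sdiff_eq_empty_iff_subset] at h
    exact C2 d hd c.1 c.2 h fun X hX => ⟨c, hc, hcd, hX⟩
  · intro i hi R hR hag hun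
    refine C2 i hi (i.1 ∩ R.biUnion fun c => c.1) (R.biUnion fun c => c.1 ∩ c.2)
      inter_subset_left ?_
    intro X hX
    obtain ⟨c, hc, h⟩ := hun X
    refine ⟨c, (hR c hc).1, (hR c hc).2, ?_⟩
    intro e he
    by_cases hei : e ∈ i.1
    · have h1 := hX e (by simp only [mem_inter, mem_biUnion]; exact ⟨hei, c, hc, he⟩)
      rw [h1]
      simp only [mem_inter, mem_biUnion]
      constructor
      · rintro ⟨d, hd, h2, h3⟩
        by_contra h4
        exact hag c hc d hd e hei ⟨he, h2, by tauto⟩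
      · intro h2
        exact ⟨c, hc, he, h2⟩
    · exact h e (mem_sdiff.2 ⟨he, hei⟩)
  · intro i hi X
    by_contra hno
    push Not at hno
    set v : Finset α := univ.filter fun e => if e ∈ i.1 then e ∈ i.2 else e ∈ X with hv
    have hvi : Mt v i := by
      intro e he
      simp [hv, he]
    have hvF : v ∉ F := (hC v).2 ⟨i, hi, hvi⟩
    refine hcon v hvF (corner F hF i (hCF i hi) v hvi ?_)
    intro e he
    refine ⟨univ.filter fun f => ¬ (f = e ↔ f ∈ v), ?_, ?_⟩
    · by_contra hnF
      obtain ⟨c, hc, hm⟩ := (hC _).1 hnF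
      have hm' : ∀ f ∈ c.1, (¬ (f = e ↔ f ∈ v) ↔ f ∈ c.2) := by
        intro f hf
        have := hm f hf
        simpa only [mem_filter, mem_univ, true_and] using this
      have hci : c ≠ i := by
        rintro rfl
        have h1 := hm' e he
        have h2 := hvi e he
        tauto
      have hcl : ∀ f, Clash i c f → f = e := by
        intro f hf
        by_contra hfe
        have h1 := hm' f hf.2.1
        have h2 := hvi f hf.1
        have h3 := hf.2.2
        tauto
      obtain ⟨f, hf, h⟩ := hno c hc hci (fun e f h1 h2 => (hcl e h1).trans (hcl f h2).symm)
      rw [mem_sdiff] at hf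
      have h1 := hm' f hf.1
      have h2 : f ≠ e := fun h => hf.2 (h ▸ he)
      have h3 : f ∈ v ↔ f ∈ X := by simp [hv, hf.2]
      tauto
    · intro f hf
      simp only [mem_filter, mem_univ, true_and]
      tauto

lemma shFam_eq {n : ℕ} (F : Finset (Finset (Fin n))) : ShFam F = F.shatterer := by
  ext S
  simp only [ShFam, mem_filter, mem_univ, true_and, mem_shatterer, shatters_iff]
  simp only [inter_comm S]

end Elim

/-- The elimination conjecture holds when the Sperner family has size at most four. -/
theorem stmt_9 {n : ℕ} (𝓢 : Finset (Finset (Fin n))) (h : Finset (Fin n) → Finset (Fin n))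
    (hSperner : IsSperner 𝓢) (hne : 𝓢.Nonempty) (hcard : 𝓢.card ≤ 4)
    (hsub : ∀ S ∈ 𝓢, h S ⊆ S) (hext : SExtremal (FFam 𝓢 h)) :
    ∃ F ∉ FFam 𝓢 h, SExtremal (insert F (FFam 𝓢 h)) := by
  unfold SExtremal at hext ⊢
  simp only [Elim.shFam_eq] at hext ⊢
  have hmem : ∀ X, X ∉ FFam 𝓢 h ↔ ∃ S ∈ 𝓢, Elim.Mt X (S, h S) := by
    intro X
    simp only [FFam, mem_sdiff, mem_univ, true_and, not_not, mem_biUnion, Q, mem_filter]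
    refine exists_congr fun S => and_congr_right fun hS => ?_
    constructor
    · intro hX e he
      simp only at he ⊢
      rw [← hX]
      simp [he]
    · intro hX
      ext e
      simp only [mem_inter]
      constructor
      · rintro ⟨h1, h2⟩
        exact (hX e h2).1 h1
      · intro h1
        exact ⟨(hX e (hsub S hS h1)).2 h1, hsub S hS h1⟩
  obtain ⟨v, h1, h2⟩ := Elim.main (FFam 𝓢 h) hext (by
    obtain ⟨S, hS⟩ := hne
    exact ⟨h S, (hmem _).2 ⟨S, hS, fun e _ => Iff.rfl⟩⟩)
    ⟨𝓢.image fun S => (S, h S), card_image_le.trans hcard, by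
      intro X
      rw [hmem]
      simp⟩
  exact ⟨v, h1, h2⟩
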